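/- Let H be a finite simple graph on a vertex set V with |V| even, and suppose every connected component of H has deficiency exactly 1, so that H has 2i components for some integer i ≥ 1. Then opt(H) = 2i - 1. -/

import Mathlib

/-- The maximum cardinality of a matching in a simple graph `H`. -/
noncomputable def maxMatchingCard {V : Type*} (H : SimpleGraph V) : ℕ :=
  sSup {n : ℕ | ∃ M : H.Subgraph, M.IsMatching ∧ M.edgeSet.ncard = n}

/-- The deficiency of a finite simple graph `H`: the number of vertices minus twice the
maximum cardinality of a matching. -/
noncomputable def deficiency {V : Type*} [Fintype V] (H : SimpleGraph V) : ℕ :=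
  Fintype.card V - 2 * maxMatchingCard H

/-- The deficiency of a connected component `K` of `H`: the number of vertices of `K` minus
twice the maximum cardinality of a matching in (the subgraph of `H` induced on) `K`. -/
noncomputable def compDeficiency {V : Type*} (H : SimpleGraph V)
    (K : H.ConnectedComponent) : ℕ :=
  K.supp.ncard - 2 * maxMatchingCard (H.induce K.supp)

/-- `H` has a perfect matching. -/
def HasPerfectMatching {V : Type*} (H : SimpleGraph V) : Prop :=
  ∃ M : H.Subgraph, M.IsPerfectMatching

/-- The set of cardinalities of sets `F` of non-edges of `H` (unordered pairs of distinct
vertices that are not edges of `H`) whose addition makes `H` connected and perfectly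
matchable.  Its least element is `opt H`. -/
def optSet {V : Type*} (H : SimpleGraph V) : Set ℕ :=
  {n : ℕ | ∃ F : Finset (Sym2 V),
    (∀ e ∈ F, ¬ e.IsDiag) ∧ (∀ e ∈ F, e ∉ H.edgeSet) ∧
    (H ⊔ SimpleGraph.fromEdgeSet (↑F : Set (Sym2 V))).Connected ∧
    HasPerfectMatching (H ⊔ SimpleGraph.fromEdgeSet (↑F : Set (Sym2 V))) ∧
    F.card = n}

/-- `c(H)`: the number of connected components of `H`. -/
noncomputable def numComponents {V : Type*} (H : SimpleGraph V) : ℕ :=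
  Nat.card H.ConnectedComponent

/-- `c₊(H)`: the number of connected components of `H` with positive deficiency. -/
noncomputable def cPlus {V : Type*} (H : SimpleGraph V) : ℕ :=
  Nat.card {K : H.ConnectedComponent // 0 < compDeficiency H K}

/-- `c₀(H)`: the number of connected components of `H` with deficiency zero. -/
noncomputable def cZero {V : Type*} (H : SimpleGraph V) : ℕ :=
  Nat.card {K : H.ConnectedComponent // compDeficiency H K = 0}

/-- A matching covers exactly twice as many vertices as it has edges. -/
theorem SimpleGraph.Subgraph.IsMatching.ncard_verts_eq {V : Type*} [Finite V]
    {G : SimpleGraph V} {M : G.Subgraph} (hM : M.IsMatching) :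
    M.verts.ncard = 2 * M.edgeSet.ncard := by
  classical
  have := Fintype.ofFinite V
  have h := M.spanningCoe.sum_degrees_eq_twice_card_edges
  have hdeg : ∀ v, M.spanningCoe.degree v = if v ∈ M.verts then 1 else 0 := by
    intro v
    rw [SimpleGraph.Subgraph.degree_spanningCoe]
    split_ifs with hv
    · exact SimpleGraph.Subgraph.isMatching_iff_forall_degree.1 hM v hv
    · exact SimpleGraph.Subgraph.degree_of_notMem_verts hv
  simp only [hdeg, Finset.sum_boole, Nat.cast_id] at h
  rw [← SimpleGraph.Subgraph.edgeSet_spanningCoe, ← SimpleGraph.coe_edgeFinset,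
    Set.ncard_coe_finset, ← h, ← Set.ncard_coe_finset]
  congr 1
  ext; simp

/-- In a component of deficiency one, some matching misses exactly one vertex. -/
theorem exists_isMatching_compl_verts_eq_singleton {V : Type*} [Finite V] {H : SimpleGraph V}
    {K : H.ConnectedComponent} (hK : compDeficiency H K = 1) :
    ∃ M : (H.induce K.supp).Subgraph, M.IsMatching ∧ ∃ r, M.vertsᶜ = {r} := by
  obtain ⟨M, hM, hcard⟩ : maxMatchingCard (H.induce K.supp) ∈ {n : ℕ |
      ∃ M : (H.induce K.supp).Subgraph, M.IsMatching ∧ M.edgeSet.ncard = n} := by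
    refine Nat.sSup_mem ⟨0, ⊥, fun v hv => hv.elim, by simp⟩ ⟨Nat.card K.supp, ?_⟩
    rintro _ ⟨M, hM, rfl⟩
    have := hM.ncard_verts_eq
    have := Set.ncard_le_card M.verts
    omega
  refine ⟨M, hM, Set.ncard_eq_one.1 ?_⟩
  have h₁ := hM.ncard_verts_eq
  have h₂ := Set.ncard_add_ncard_compl M.verts
  have h₃ : Nat.card K.supp = K.supp.ncard := rfl
  unfold compDeficiency at hK
  omega

/-- Joining the components of `H` to one connected graph takes at least one edge fewer than
there are components. -/
theorem SimpleGraph.Connected.card_connectedComponent_le_card_add_one {V : Type*} [Finite V]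
    {H : SimpleGraph V} {F : Finset (Sym2 V)}
    (hF : (H ⊔ SimpleGraph.fromEdgeSet (F : Set (Sym2 V))).Connected) :
    Nat.card H.ConnectedComponent ≤ F.card + 1 := by
  classical
  let Q : SimpleGraph H.ConnectedComponent :=
    SimpleGraph.fromEdgeSet
      (F.image (Sym2.map H.connectedComponentMk) : Finset (Sym2 H.ConnectedComponent))
  have hreach : ∀ u v, (H ⊔ SimpleGraph.fromEdgeSet (F : Set (Sym2 V))).Reachable u v →
      Q.Reachable (H.connectedComponentMk u) (H.connectedComponentMk v) := by
    rintro u v ⟨p⟩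
    induction p with
    | nil => rfl
    | @cons a b c hab _ ih =>
      refine SimpleGraph.Reachable.trans ?_ ih
      by_cases hne : H.connectedComponentMk a = H.connectedComponentMk b
      · rw [hne]
      · rcases hab with hab | hab
        · exact (hne (SimpleGraph.ConnectedComponent.sound hab.reachable)).elim
        · refine SimpleGraph.Adj.reachable ?_
          rw [SimpleGraph.fromEdgeSet_adj] at hab ⊢
          exact ⟨Finset.mem_coe.2 (Finset.mem_image.2 ⟨_, hab.1, rfl⟩), hne⟩
  have : Nonempty H.ConnectedComponent := hF.nonempty.map H.connectedComponentMk
  have hQ : Q.Connected := by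
    refine ⟨fun K L => ?_⟩
    induction K using SimpleGraph.ConnectedComponent.ind with | _ u
    induction L using SimpleGraph.ConnectedComponent.ind with | _ v
    exact hreach u v (hF u v)
  refine hQ.card_vert_le_card_edgeSet_add_one.trans (Nat.succ_le_succ ?_)
  refine le_trans ?_ (Finset.card_image_le (f := Sym2.map H.connectedComponentMk))
  rw [← Set.ncard_coe_finset]
  refine Set.ncard_le_ncard ?_ (Finset.finite_toSet _)
  rw [SimpleGraph.edgeSet_fromEdgeSet]
  exact Set.sdiff_subset

/-- Near-perfect matchings of the components of `H` extend to a perfect matching of a larger graph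
in which the missed vertices are paired up. -/
theorem hasPerfectMatching_of_involutive {V : Type*} {H G : SimpleGraph V} (hle : H ≤ G)
    (M : ∀ K : H.ConnectedComponent, (H.induce K.supp).Subgraph) (hM : ∀ K, (M K).IsMatching)
    (r : ∀ K : H.ConnectedComponent, K.supp) (hr : ∀ K, (M K).vertsᶜ = {r K})
    (σ : H.ConnectedComponent → H.ConnectedComponent) (hσ : Function.Involutive σ)
    (hadj : ∀ K, G.Adj (r K) (r (σ K))) : HasPerfectMatching G := by
  have hmem : ∀ K v, v ∈ (M K).verts ↔ v ≠ r K := by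
    intro K v
    rw [← not_iff_not, ← Set.mem_compl_iff, hr]
    simp
  have hinj : ∀ K L, (r K : V) = r L → K = L := fun K L h =>
    (r K).2.symm.trans ((congrArg H.connectedComponentMk h).trans (r L).2)
  let S : G.Subgraph :=
    { verts := Set.univ
      Adj := fun a b => (∃ K, ∃ (ha : a ∈ K.supp) (hb : b ∈ K.supp), (M K).Adj ⟨a, ha⟩ ⟨b, hb⟩) ∨
        ∃ K, a = r K ∧ b = r (σ K)
      adj_sub := by
        rintro a b (⟨K, ha, hb, h⟩ | ⟨K, rfl, rfl⟩)
        · exact hle h.adj_sub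
        · exact hadj K
      edge_vert := fun _ => Set.mem_univ _
      symm := ⟨by
        rintro a b (⟨K, ha, hb, h⟩ | ⟨K, rfl, rfl⟩)
        · exact Or.inl ⟨K, hb, ha, h.symm⟩
        · exact Or.inr ⟨σ K, rfl, by rw [hσ K]⟩⟩ }
  refine ⟨S, SimpleGraph.Subgraph.isPerfectMatching_iff.2 fun v => ?_⟩
  obtain ⟨K, hv⟩ : ∃ K : H.ConnectedComponent, v ∈ K.supp := ⟨H.connectedComponentMk v, rfl⟩
  by_cases hvr : (⟨v, hv⟩ : K.supp) = r K
  · obtain rfl : v = r K := congrArg Subtype.val hvr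
    refine ⟨r (σ K), Or.inr ⟨K, rfl, rfl⟩, ?_⟩
    rintro w (⟨L, ha, hb, h⟩ | ⟨L, h, rfl⟩)
    · obtain rfl : K = L := hv.symm.trans ha
      exact ((hmem K _).1 h.fst_mem rfl).elim
    · rw [hinj _ _ h]
  · obtain ⟨w, hw, huniq⟩ := hM K ((hmem K _).2 hvr)
    refine ⟨w, Or.inl ⟨K, hv, w.2, hw⟩, ?_⟩
    rintro x (⟨L, ha, hb, h⟩ | ⟨L, rfl, rfl⟩)
    · obtain rfl : K = L := hv.symm.trans ha
      exact congrArg Subtype.val (huniq ⟨x, hb⟩ h)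
    · obtain rfl : K = L := hv.symm.trans (r L).2
      exact (hvr rfl).elim

/-- Case (iv) of the proof of Lemma 2. Let `H` be a finite simple graph
on an even vertex set in which every connected component has deficiency exactly `1`, so
that `H` has `2·i` components for some `i ≥ 1`.  Then `opt(H) = 2·i - 1`. -/
theorem augPMST_all_components_deficiency_one {V : Type*} [Fintype V] (H : SimpleGraph V)
    (heven : Even (Fintype.card V))
    (hall : ∀ K : H.ConnectedComponent, compDeficiency H K = 1)
    (i : ℕ) (hi : 1 ≤ i) (hcount : Nat.card H.ConnectedComponent = 2 * i) :
    IsLeast (optSet H) (2 * i - 1) := by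
  classical
  refine ⟨?_, ?_⟩
  · choose M hM r hr using fun K => exists_isMatching_compl_verts_eq_singleton (hall K)
    have hr_mk : ∀ K, H.connectedComponentMk (r K) = K := fun K => (r K).2
    let e : H.ConnectedComponent ≃ Fin (2 * i) := Finite.equivFinOfCardEq hcount
    let c : ℕ → H.ConnectedComponent := fun j =>
      if h : j < 2 * i then e.symm ⟨j, h⟩ else e.symm ⟨0, by omega⟩
    have hec : ∀ j, j < 2 * i → (e (c j) : ℕ) = j := fun j hj => by simp [c, hj]
    have hce : ∀ K, c (e K) = K := fun K => by simp [c]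
    have hc_inj : ∀ j k, j < 2 * i → k < 2 * i → (r (c j) : V) = r (c k) → j = k := by
      intro j k hj hk h
      have h' := congrArg H.connectedComponentMk h
      rw [hr_mk, hr_mk] at h'
      rw [← hec j hj, ← hec k hk, h']
    let edge : ℕ → Sym2 V := fun j => s((r (c j) : V), r (c (j + 1)))
    let F : Finset (Sym2 V) := (Finset.range (2 * i - 1)).image edge
    have hstep : ∀ j, j + 1 < 2 * i →
        (H ⊔ SimpleGraph.fromEdgeSet (F : Set (Sym2 V))).Adj (r (c j)) (r (c (j + 1))) := by
      intro j hj
      refine Or.inr ((SimpleGraph.fromEdgeSet_adj _).2 ⟨Finset.mem_coe.2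
        (Finset.mem_image.2 ⟨j, Finset.mem_range.2 (by omega), rfl⟩), fun h => ?_⟩)
      have := hc_inj _ _ (by omega) hj h
      omega
    refine ⟨F, ?_, ?_, ?_, ?_, ?_⟩
    · intro a ha hdiag
      obtain ⟨j, hj, rfl⟩ := Finset.mem_image.1 ha
      rw [Finset.mem_range] at hj
      have := hc_inj j (j + 1) (by omega) (by omega) hdiag
      omega
    · intro a ha hH
      obtain ⟨j, hj, rfl⟩ := Finset.mem_image.1 ha
      rw [Finset.mem_range] at hj
      have h := SimpleGraph.ConnectedComponent.sound
        (SimpleGraph.Adj.reachable ((SimpleGraph.mem_edgeSet H).1 hH))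
      rw [hr_mk, hr_mk] at h
      have := hec j (by omega)
      rw [h, hec _ (by omega)] at this
      omega
    · have hpath : ∀ j, j < 2 * i →
          (H ⊔ SimpleGraph.fromEdgeSet (F : Set (Sym2 V))).Reachable (r (c 0)) (r (c j)) := by
        intro j
        induction j with
        | zero => exact fun _ => SimpleGraph.Reachable.refl _
        | succ j ih => exact fun hj => (ih (by omega)).trans (hstep j hj).reachable
      rw [SimpleGraph.connected_iff_exists_forall_reachable]
      refine ⟨r (c 0), fun v => (hpath (e (H.connectedComponentMk v)) (Fin.is_lt _)).trans ?_⟩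
      rw [hce]
      exact (SimpleGraph.ConnectedComponent.exact (hr_mk _)).mono le_sup_left
    · let τ : ℕ → ℕ := fun j => if Even j then j + 1 else j - 1
      have hτ : ∀ j, j < 2 * i → τ j < 2 * i ∧ τ (τ j) = j ∧ (τ j = j + 1 ∨ j = τ j + 1) := by
        intro j hj
        simp only [τ, Nat.even_iff]
        split_ifs <;> omega
      refine hasPerfectMatching_of_involutive le_sup_left M hM r hr (fun K => c (τ (e K))) ?_ ?_
      · intro K
        obtain ⟨h₁, h₂, -⟩ := hτ (e K) (Fin.is_lt _)
        simp only [hec _ h₁, h₂, hce]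
      · intro K
        obtain ⟨h₁, -, h₃ | h₃⟩ := hτ (e K) (Fin.is_lt _)
        · have := hstep (e K) (by omega)
          rwa [← h₃, hce] at this
        · have := hstep (τ (e K)) (by omega)
          rw [← h₃, hce] at this
          exact this.symm
    · rw [Finset.card_image_of_injOn, Finset.card_range]
      intro j hj k hk h
      simp only [Finset.coe_range, Set.mem_Iio] at hj hk
      rcases Sym2.eq_iff.1 h with ⟨h, -⟩ | ⟨h, h'⟩
      · exact hc_inj _ _ (by omega) (by omega) h
      · have := hc_inj _ _ (by omega) (by omega) h
        have := hc_inj _ _ (by omega) (by omega) h'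
        omega
  · rintro _ ⟨F, -, -, hF, -, rfl⟩
    have := hF.card_connectedComponent_le_card_add_one
    omega
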